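/- arXiv:2208.03765 — 3 statements merged into one kernel-verified Lean document; each statement's English description precedes it below -/
import Mathlib

section
/- Let A be a set with at least 3 elements and let ν be the non-disjointness relation on Pow₊A. If a, b, c are three distinct elements of A, then the family {{a,b}, {a,c}, {b,c}} is a clique of ν that is contained in no ultrafilter on A. Consequently, there exists a maximal clique of ν that is not an ultrafilter on A. -/
/-- `B` is a clique of the binary relation `τ`: any two elements of `B` are related. -/
def IsClique {A : Type*} (τ : A → A → Prop) (B : Set A) : Prop :=
  ∀ a ∈ B, ∀ b ∈ B, τ a b

/-- `B` is a maximal clique of `τ`: a clique maximal with respect to set inclusion. -/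
def IsMaxClique {A : Type*} (τ : A → A → Prop) (B : Set A) : Prop :=
  IsClique τ B ∧ ∀ C : Set A, IsClique τ C → B ⊆ C → B = C

/-- `Pow₊ A`: the set of all nonempty subsets of `A`. -/
def PowPlus (A : Type*) : Type _ := {S : Set A // S.Nonempty}

/-- The non-disjointness relation `ν` on `Pow₊ A`: `(X, Y) ∈ ν` iff `X ∩ Y ≠ ∅`. -/
def nu {A : Type*} (X Y : PowPlus A) : Prop := (X.1 ∩ Y.1).Nonempty

/-- Every clique of a relation extends to a maximal clique. -/
theorem IsClique.exists_isMaxClique {A : Type*} {τ : A → A → Prop} {B : Set A}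
    (hB : IsClique τ B) : ∃ M, B ⊆ M ∧ IsMaxClique τ M := by
  obtain ⟨M, hBM, hM⟩ := zorn_subset_nonempty {C | IsClique τ C} (fun c hc hchain _ => by
    refine ⟨⋃₀ c, ?_, fun s hs => Set.subset_sUnion_of_mem hs⟩
    rintro x ⟨s, hs, hxs⟩ y ⟨t, ht, hyt⟩
    rcases hchain.total hs ht with hst | hts
    · exact hc ht x (hst hxs) y hyt
    · exact hc hs x hxs y (hts hyt)) B hB
  exact ⟨M, hBM, hM.prop, fun C hC hMC => hM.eq_of_subset hC hMC⟩

/-- If `a`, `b`, `c` are three distinct elements of `A`, then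
`{{a,b}, {a,c}, {b,c}}` is a clique of the non-disjointness relation `ν` on `Pow₊ A`
contained in no ultrafilter on `A`; consequently there is a maximal clique of `ν`
that is not (the set of members of) an ultrafilter on `A`. -/
theorem triangle_clique_not_in_ultrafilter {A : Type*} (a b c : A)
    (hab : a ≠ b) (hac : a ≠ c) (hbc : b ≠ c) :
    IsClique nu {X : PowPlus A | X.1 = {a, b} ∨ X.1 = {a, c} ∨ X.1 = {b, c}} ∧
    (∀ U : Ultrafilter A,
      ¬ ({X : PowPlus A | X.1 = {a, b} ∨ X.1 = {a, c} ∨ X.1 = {b, c}}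
          ⊆ {X : PowPlus A | X.1 ∈ U})) ∧
    (∃ B : Set (PowPlus A), IsMaxClique nu B ∧
      ∀ U : Ultrafilter A, B ≠ {X : PowPlus A | X.1 ∈ U}) := by
  have hclique :
      IsClique nu {X : PowPlus A | X.1 = {a, b} ∨ X.1 = {a, c} ∨ X.1 = {b, c}} := by
    rintro X (hX | hX | hX) Y (hY | hY | hY) <;> rw [nu, hX, hY]
    exacts [⟨a, by simp⟩, ⟨a, by simp⟩, ⟨b, by simp⟩, ⟨a, by simp⟩, ⟨a, by simp⟩,
      ⟨c, by simp⟩, ⟨b, by simp⟩, ⟨c, by simp⟩, ⟨b, by simp⟩]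
  have hultra : ∀ U : Ultrafilter A,
      ¬ ({X : PowPlus A | X.1 = {a, b} ∨ X.1 = {a, c} ∨ X.1 = {b, c}}
          ⊆ {X : PowPlus A | X.1 ∈ U}) := by
    intro U h
    have h₁ : ({a, b} : Set A) ∈ U := @h ⟨{a, b}, a, by simp⟩ (Or.inl rfl)
    have h₂ : ({a, c} : Set A) ∈ U := @h ⟨{a, c}, a, by simp⟩ (Or.inr (Or.inl rfl))
    have h₃ : ({b, c} : Set A) ∈ U := @h ⟨{b, c}, b, by simp⟩ (Or.inr (Or.inr rfl))
    obtain ⟨x, ⟨hx₁, hx₂⟩, hx₃⟩ :=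
      U.nonempty_of_mem (Filter.inter_mem (Filter.inter_mem h₁ h₂) h₃)
    simp only [Set.mem_insert_iff, Set.mem_singleton_iff] at hx₁ hx₂ hx₃
    grind
  obtain ⟨M, hM, hmax⟩ := hclique.exists_isMaxClique
  exact ⟨hclique, hultra, M, hmax, fun U hU => hultra U (hU ▸ hM)⟩
end

section
/- Let M = {1,2,3}, let A = Pow₊M with the operation + defined by B + C = B ∪ C if |B| = |C| = 1 and B + C = M otherwise, and let ν be the non-disjointness relation on A, whose maximal cliques are S₁ = {{1},{1,2},{1,3},{1,2,3}}, S₂ = {{2},{1,2},{2,3},{1,2,3}}, S₃ = {{3},{1,3},{2,3},{1,2,3}}, and S = {{1,2},{1,3},{2,3},{1,2,3}}. Then in the tolerance quotient (A;+)/ν one has S₁ + S₂ = {S₁, S₂, S}; in particular S₁ + S₂ is not a subset of {S₁, S₂, S₃}. -/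
/-- The operation `+` on `A = Pow₊ M` for `M = {1,2,3}` (modelled as `Fin 3`):
`B + C = B ∪ C` if `|B| = |C| = 1`, and `B + C = M` otherwise. -/
noncomputable def addA (B C : PowPlus (Fin 3)) : PowPlus (Fin 3) :=
  letI := Classical.dec ((∃ b, B.1 = {b}) ∧ (∃ c, C.1 = {c}))
  if (∃ b, B.1 = {b}) ∧ (∃ c, C.1 = {c}) then ⟨B.1 ∪ C.1, B.2.inl⟩
  else ⟨Set.univ, Set.univ_nonempty⟩

/-- The sum of two tolerance blocks in the tolerance quotient `(A; +)/ν`: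
the set of tolerance blocks `B` of `ν` with `b₁ + b₂ ∈ B` for all `b₁ ∈ B₁, b₂ ∈ B₂`. -/
def qAdd (B₁ B₂ : Set (PowPlus (Fin 3))) : Set (Set (PowPlus (Fin 3))) :=
  {B | IsMaxClique nu B ∧ ∀ b₁ ∈ B₁, ∀ b₂ ∈ B₂, addA b₁ b₂ ∈ B}

/-- `S₁ = {{1}, {1,2}, {1,3}, {1,2,3}}` (with `M = {1,2,3}` modelled as `Fin 3`). -/
def S₁ : Set (PowPlus (Fin 3)) :=
  {X | X.1 = {0} ∨ X.1 = {0, 1} ∨ X.1 = {0, 2} ∨ X.1 = {0, 1, 2}}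

/-- `S₂ = {{2}, {1,2}, {2,3}, {1,2,3}}`. -/
def S₂ : Set (PowPlus (Fin 3)) :=
  {X | X.1 = {1} ∨ X.1 = {0, 1} ∨ X.1 = {1, 2} ∨ X.1 = {0, 1, 2}}

/-- `S₃ = {{3}, {1,3}, {2,3}, {1,2,3}}`. -/
def S₃ : Set (PowPlus (Fin 3)) :=
  {X | X.1 = {2} ∨ X.1 = {0, 2} ∨ X.1 = {1, 2} ∨ X.1 = {0, 1, 2}}

/-- `S = {{1,2}, {1,3}, {2,3}, {1,2,3}}`. -/
def S : Set (PowPlus (Fin 3)) :=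
  {X | X.1 = {0, 1} ∨ X.1 = {0, 2} ∨ X.1 = {1, 2} ∨ X.1 = {0, 1, 2}}

/-- A nonempty subset of `A` as an element of `Pow₊ A`. -/
def PowPlus.mk {A : Type*} (s : Set A) (hs : s.Nonempty) : PowPlus A := ⟨s, hs⟩

@[simp]
theorem PowPlus.val_mk {A : Type*} (s : Set A) (hs : s.Nonempty) : (PowPlus.mk s hs).1 = s := rfl

theorem nu_iff (X Y : PowPlus (Fin 3)) :
    nu X Y ↔ 0 ∈ X.1 ∧ 0 ∈ Y.1 ∨ 1 ∈ X.1 ∧ 1 ∈ Y.1 ∨ 2 ∈ X.1 ∧ 2 ∈ Y.1 := by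
  simp [nu, Set.Nonempty, Fin.exists_fin_succ]

theorem mem_S₁_iff (X : PowPlus (Fin 3)) : X ∈ S₁ ↔ 0 ∈ X.1 := by
  simp [S₁, Set.ext_iff, Fin.forall_fin_succ]
  tauto

theorem mem_S₂_iff (X : PowPlus (Fin 3)) : X ∈ S₂ ↔ 1 ∈ X.1 := by
  simp [S₂, Set.ext_iff, Fin.forall_fin_succ]
  tauto

theorem mem_S₃_iff (X : PowPlus (Fin 3)) : X ∈ S₃ ↔ 2 ∈ X.1 := by
  simp [S₃, Set.ext_iff, Fin.forall_fin_succ]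
  tauto

theorem mem_S_iff (X : PowPlus (Fin 3)) :
    X ∈ S ↔ 0 ∈ X.1 ∧ 1 ∈ X.1 ∨ 0 ∈ X.1 ∧ 2 ∈ X.1 ∨ 1 ∈ X.1 ∧ 2 ∈ X.1 := by
  simp [S, Set.ext_iff, Fin.forall_fin_succ]
  tauto

theorem isMaxClique_of_forall_mem {A : Type*} {τ : A → A → Prop} {B : Set A}
    (hB : IsClique τ B) (h : ∀ x, (∀ b ∈ B, τ x b) → x ∈ B) : IsMaxClique τ B :=
  ⟨hB, fun _ hC hBC ↦ hBC.antisymm fun x hx ↦ h x fun b hb ↦ hC x hx b (hBC hb)⟩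

/-- The set of all `X ∈ Pow₊ A` with `a ∈ X` is a tolerance block of `ν`. -/
theorem isMaxClique_nu_of_mem_iff {A : Type*} {B : Set (PowPlus A)} (a : A)
    (h : ∀ X, X ∈ B ↔ a ∈ X.1) : IsMaxClique nu B := by
  refine isMaxClique_of_forall_mem (fun X hX Y hY ↦ ⟨a, (h X).1 hX, (h Y).1 hY⟩) fun X hX ↦ ?_
  obtain ⟨b, hb, rfl⟩ := hX (.mk {a} (Set.singleton_nonempty a)) ((h _).2 rfl)
  exact (h X).2 hb

theorem isMaxClique_S : IsMaxClique nu S := by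
  refine isMaxClique_of_forall_mem (fun X hX Y hY ↦ ?_) fun X hX ↦ ?_
  · rw [mem_S_iff] at hX hY
    rw [nu_iff]
    tauto
  · have h₀₁ := hX (.mk {0, 1} (Set.insert_nonempty _ _)) (by simp [mem_S_iff])
    have h₀₂ := hX (.mk {0, 2} (Set.insert_nonempty _ _)) (by simp [mem_S_iff])
    have h₁₂ := hX (.mk {1, 2} (Set.insert_nonempty _ _)) (by simp [mem_S_iff])
    simp [nu_iff] at h₀₁ h₀₂ h₁₂
    rw [mem_S_iff]
    tauto

theorem addA_singleton (i j : Fin 3) :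
    addA (.mk {i} (Set.singleton_nonempty i)) (.mk {j} (Set.singleton_nonempty j)) =
      .mk {i, j} (Set.insert_nonempty _ _) :=
  (if_pos ⟨⟨i, rfl⟩, ⟨j, rfl⟩⟩).trans (Subtype.ext Set.singleton_union)

theorem mem_addA {X Y : PowPlus (Fin 3)} (i : Fin 3) (h : i ∈ X.1 ∨ i ∈ Y.1) :
    i ∈ (addA X Y).1 := by
  by_cases hXY : (∃ b, X.1 = {b}) ∧ ∃ c, Y.1 = {c}
  · have hadd : addA X Y = .mk (X.1 ∪ Y.1) X.2.inl := if_pos hXY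
    rw [hadd]
    exact h
  · have hadd : addA X Y = .mk Set.univ Set.univ_nonempty := if_neg hXY
    rw [hadd]
    trivial

theorem eq_of_isMaxClique {B : Set (PowPlus (Fin 3))} (hB : IsMaxClique nu B)
    (h : PowPlus.mk {0, 1} (Set.insert_nonempty 0 _) ∈ B) :
    B = S₁ ∨ B = S₂ ∨ B = S := by
  by_cases h₀ : ∀ X ∈ B, 0 ∈ X.1
  · exact .inl <| hB.2 _ (isMaxClique_nu_of_mem_iff 0 mem_S₁_iff).1
      fun X hX ↦ (mem_S₁_iff X).2 (h₀ X hX)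
  by_cases h₁ : ∀ X ∈ B, 1 ∈ X.1
  · exact .inr <| .inl <| hB.2 _ (isMaxClique_nu_of_mem_iff 1 mem_S₂_iff).1
      fun X hX ↦ (mem_S₂_iff X).2 (h₁ X hX)
  push Not at h₀ h₁
  obtain ⟨Y, hY, hY₀⟩ := h₀
  obtain ⟨Z, hZ, hZ₁⟩ := h₁
  refine .inr <| .inr <| hB.2 _ isMaxClique_S.1 fun X hX ↦ ?_
  have hXU := hB.1 X hX _ h
  have hXY := hB.1 X hX Y hY
  have hXZ := hB.1 X hX Z hZ
  simp [nu_iff] at hXU hXY hXZ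
  rw [mem_S_iff]
  tauto

/-- In the tolerance quotient `(Pow₊ M; +)/ν` one has `S₁ + S₂ = {S₁, S₂, S}`;
in particular `S₁ + S₂` is not a subset of `{S₁, S₂, S₃}`. -/
theorem qAdd_S₁_S₂ :
    qAdd S₁ S₂ = {S₁, S₂, S} ∧ ¬ qAdd S₁ S₂ ⊆ {S₁, S₂, S₃} := by
  have key : qAdd S₁ S₂ = {S₁, S₂, S} := by
    ext B
    constructor
    · rintro ⟨hB, hadd⟩
      refine eq_of_isMaxClique hB ?_
      rw [← addA_singleton]
      exact hadd _ ((mem_S₁_iff _).2 (Set.mem_singleton 0)) _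
        ((mem_S₂_iff _).2 (Set.mem_singleton 1))
    · rintro (rfl | rfl | rfl)
      · exact ⟨isMaxClique_nu_of_mem_iff 0 mem_S₁_iff, fun X hX Y _ ↦
          (mem_S₁_iff _).2 (mem_addA 0 (.inl ((mem_S₁_iff X).1 hX)))⟩
      · exact ⟨isMaxClique_nu_of_mem_iff 1 mem_S₂_iff, fun X _ Y hY ↦
          (mem_S₂_iff _).2 (mem_addA 1 (.inr ((mem_S₂_iff Y).1 hY)))⟩
      · exact ⟨isMaxClique_S, fun X hX Y hY ↦ (mem_S_iff _).2 (.inl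
          ⟨mem_addA 0 (.inl ((mem_S₁_iff X).1 hX)), mem_addA 1 (.inr ((mem_S₂_iff Y).1 hY))⟩)⟩
  refine ⟨key, fun hsub ↦ ?_⟩
  have not_mem_S (i : Fin 3) :
      PowPlus.mk {i} (Set.singleton_nonempty i) ∉ S := by
    rw [mem_S_iff]
    fin_cases i <;> simp
  have hS : S ∈ qAdd S₁ S₂ := key ▸ .inr (.inr rfl)
  rcases hsub hS with h | h | h
  · exact not_mem_S 0 (h ▸ (mem_S₁_iff _).2 rfl)
  · exact not_mem_S 1 (h ▸ (mem_S₂_iff _).2 rfl)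
  · exact not_mem_S 2 (h ▸ (mem_S₃_iff _).2 rfl)
end

section
/- Every multi-algebra is a full covering quotient of an algebra. Precisely: let (M;F) be a multi-algebra over a signature. Then there exist an algebra (A;F) over the same signature, a tolerance τ on (A;F), and a full covering 𝒞 of (A;F) consisting of tolerance blocks of τ, such that the full covering quotient (A;F)/𝒞 is isomorphic to (M;F) as a multi-algebra. -/
universe u v

/-- `τ` is a tolerance on the algebra with operations `op` (indexed by the operation
symbols `f : F` of arity `arity f`): a reflexive, symmetric binary relation with the
substitution property. -/
def IsTolerance {F : Type*} {arity : F → ℕ} {A : Type*}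
    (op : ∀ f : F, (Fin (arity f) → A) → A) (τ : A → A → Prop) : Prop :=
  (∀ a : A, τ a a) ∧ (∀ a b : A, τ a b → τ b a) ∧
  ∀ (f : F) (a b : Fin (arity f) → A), (∀ i, τ (a i) (b i)) → τ (op f a) (op f b)

/-- Every multi-algebra is a full covering quotient of an algebra: given a multi-algebra
`(M; F)` (multi-operations `mop` with nonempty values), there are an algebra `(A; F)`
(operations `op`), a tolerance `τ` on it, and a full covering `𝒞` of `A` consisting of
tolerance blocks of `τ` — pairwise incomparable, covering `A`, and inducing `τ` — such
that the full covering quotient `(A; F)/𝒞` is isomorphic to `(M; F)`: there is a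
bijection `φ : 𝒞 → M` with `φ '' f(C₁,…,Cₙ) = f(φ C₁,…,φ Cₙ)` for every `f ∈ F`. -/
theorem multialgebra_is_full_covering_quotient {F : Type v} (arity : F → ℕ)
    {M : Type u} [Nonempty M] (mop : ∀ f : F, (Fin (arity f) → M) → Set M)
    (hne : ∀ (f : F) (m : Fin (arity f) → M), (mop f m).Nonempty) :
    ∃ (A : Type u) (_ : Nonempty A) (op : ∀ f : F, (Fin (arity f) → A) → A)
      (τ : A → A → Prop) (𝒞 : Set (Set A)),
      IsTolerance op τ ∧
      (∀ C ∈ 𝒞, IsMaxClique τ C) ∧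
      (∀ C ∈ 𝒞, ∀ D ∈ 𝒞, C ≠ D → ¬ C ⊆ D) ∧
      (⋃₀ 𝒞 = Set.univ) ∧
      (∀ a b : A, τ a b ↔ ∃ C ∈ 𝒞, a ∈ C ∧ b ∈ C) ∧
      ∃ φ : 𝒞 → M, Function.Bijective φ ∧
        ∀ (f : F) (Cs : Fin (arity f) → 𝒞),
          φ '' {C : 𝒞 | ∀ c : Fin (arity f) → A,
              (∀ i, c i ∈ (Cs i : Set A)) → op f c ∈ (C : Set A)}
            = mop f (fun i => φ (Cs i)) := by
  let block : M → Set {S : Set M // S.Nonempty} := fun m => {S | m ∈ S.1}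
  let pt : M → {S : Set M // S.Nonempty} := fun m => ⟨{m}, Set.singleton_nonempty m⟩
  have block_le : ∀ m n, block m ⊆ block n → m = n := fun m n h =>
    (show n ∈ ({m} : Set M) from h (show pt m ∈ block m from rfl)).symm
  have block_inj : Function.Injective block := fun m n h => block_le m n h.le
  let e : M ≃ Set.range block := Equiv.ofInjective block block_inj
  have mem_iff : ∀ (C : Set.range block) (S : {S : Set M // S.Nonempty}),
      S ∈ (C : Set {S : Set M // S.Nonempty}) ↔ e.symm C ∈ S.1 := by
    intro C S
    obtain ⟨m, rfl⟩ := e.surjective C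
    rw [e.symm_apply_apply]
    rfl
  refine ⟨{S : Set M // S.Nonempty}, ⟨pt (Classical.arbitrary M)⟩,
    fun f S => ⟨{x | ∃ m, (∀ i, m i ∈ (S i).1) ∧ x ∈ mop f m}, ?_⟩,
    fun S T => (S.1 ∩ T.1).Nonempty, Set.range block, ⟨?_, ?_, ?_⟩, ?_, ?_, ?_, ?_,
    e.symm, e.symm.bijective, ?_⟩
  · choose m hm using fun i => (S i).2
    obtain ⟨x, hx⟩ := hne f m
    exact ⟨x, m, hm, hx⟩
  · rintro ⟨S, x, hx⟩
    exact ⟨x, hx, hx⟩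
  · rintro S T ⟨x, hS, hT⟩
    exact ⟨x, hT, hS⟩
  · intro f S T h
    choose m hS hT using h
    obtain ⟨x, hx⟩ := hne f m
    exact ⟨x, ⟨m, hS, hx⟩, ⟨m, hT, hx⟩⟩
  · rintro _ ⟨m, rfl⟩
    refine ⟨fun S hS T hT => ⟨m, hS, hT⟩, fun C hC hle => hle.antisymm fun S hS => ?_⟩
    obtain ⟨x, hx, rfl⟩ := hC S hS (pt m) (hle rfl)
    exact hx
  · rintro _ ⟨m, rfl⟩ _ ⟨n, rfl⟩ h hle
    exact h (congrArg block (block_le m n hle))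
  · refine Set.eq_univ_of_forall fun ⟨S, x, hx⟩ => ⟨block x, ⟨x, rfl⟩, hx⟩
  · intro S T
    constructor
    · rintro ⟨x, hS, hT⟩
      exact ⟨block x, ⟨x, rfl⟩, hS, hT⟩
    · rintro ⟨_, ⟨x, rfl⟩, hS, hT⟩
      exact ⟨x, hS, hT⟩
  · intro f Cs
    ext x
    rw [Equiv.image_eq_preimage_symm]
    simp only [mem_iff, Set.mem_preimage, Set.mem_ofPred_eq, Equiv.symm_symm,
      Equiv.symm_apply_apply]
    constructor
    · intro h
      obtain ⟨m, hm, hx⟩ := h (fun i => pt (e.symm (Cs i))) fun i => rfl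
      rwa [show m = fun i => e.symm (Cs i) from funext hm] at hx
    · exact fun hx c hc => ⟨_, hc, hx⟩
end
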